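/- For every n ≥ 2 and k ≥ 2 there is a constant δ'(n,k) > 0 such that for every nonzero homogeneous harmonic polynomial h : ℝⁿ → ℝ of degree k and every r > 0, the local flatness of the zero set at the origin satisfies θ_{Σ_h}(0,r) ≥ δ'(n,k). In other words, the zero set of a homogeneous harmonic polynomial of degree at least 2 is uniformly far from every hyperplane in Hausdorff distance at every scale. -/

import Mathlib

open MvPolynomial Metric Filter
open scoped ENNReal

/-- Evaluate a multivariate polynomial at a point of Euclidean space. -/
noncomputable def evalPt {n : ℕ} (p : MvPolynomial (Fin n) ℝ)
    (y : EuclideanSpace ℝ (Fin n)) : ℝ :=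
  MvPolynomial.eval (fun i => y i) p

/-- The zero set of a polynomial. -/
def zeroSet {n : ℕ} (p : MvPolynomial (Fin n) ℝ) : Set (EuclideanSpace ℝ (Fin n)) :=
  {y | evalPt p y = 0}

/-- The polynomial y ↦ p(y + x). -/
noncomputable def translatePoly {n : ℕ} (p : MvPolynomial (Fin n) ℝ)
    (x : EuclideanSpace ℝ (Fin n)) : MvPolynomial (Fin n) ℝ :=
  MvPolynomial.bind₁ (fun i => MvPolynomial.X i + MvPolynomial.C (x i)) p

/-- The homogeneous part of degree `k` of `p` centered at `x`. -/
noncomputable def homPart {n : ℕ} (p : MvPolynomial (Fin n) ℝ)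
    (x : EuclideanSpace ℝ (Fin n)) (k : ℕ) : MvPolynomial (Fin n) ℝ :=
  MvPolynomial.homogeneousComponent k (translatePoly p x)

/-- The sup norm of |q| on the closed ball B(0,r), as an extended nonnegative real. -/
noncomputable def supNormBall {n : ℕ} (q : MvPolynomial (Fin n) ℝ) (r : ℝ) : ℝ≥0∞ :=
  ⨆ y ∈ Metric.closedBall (0 : EuclideanSpace ℝ (Fin n)) r, ENNReal.ofReal |evalPt q y|

/-- ζ_k(p,x,r): the relative size of the homogeneous part of degree k of a polynomial of
degree d, centered at x, on the ball of radius r. -/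
noncomputable def zeta {n : ℕ} (d : ℕ) (p : MvPolynomial (Fin n) ℝ)
    (x : EuclideanSpace ℝ (Fin n)) (k : ℕ) (r : ℝ) : ℝ≥0∞ :=
  ⨆ j ∈ (Finset.range (d + 1)).erase k,
    supNormBall (homPart p x j) r / supNormBall (homPart p x k) r

/-- A polynomial is harmonic if its Laplacian vanishes. -/
def IsHarmonic {n : ℕ} (p : MvPolynomial (Fin n) ℝ) : Prop :=
  ∑ i : Fin n, MvPolynomial.pderiv i (MvPolynomial.pderiv i p) = 0

/-- The local flatness θ_Σ(x,r): the normalized minimal Hausdorff distance between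
Σ ∩ B(x,r) and (x + L) ∩ B(x,r) over hyperplanes L through the origin. -/
noncomputable def flatness {n : ℕ} (A : Set (EuclideanSpace ℝ (Fin n)))
    (x : EuclideanSpace ℝ (Fin n)) (r : ℝ) : ℝ :=
  (1 / r) * ⨅ L : {L : Submodule ℝ (EuclideanSpace ℝ (Fin n)) // Module.finrank ℝ L = n - 1},
    Metric.hausdorffDist (A ∩ Metric.closedBall x r)
      (((fun y => x + y) '' (L.1 : Set (EuclideanSpace ℝ (Fin n)))) ∩ Metric.closedBall x r)

/-- Dp(x) ≠ 0 : some partial derivative of p is nonzero at x. -/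
def gradNeZero {n : ℕ} (p : MvPolynomial (Fin n) ℝ) (x : EuclideanSpace ℝ (Fin n)) : Prop :=
  ∃ i : Fin n, MvPolynomial.eval (fun j => x j) (MvPolynomial.pderiv i p) ≠ 0

/-- Sup of |h| on the unit sphere. -/
noncomputable def sphereSup {n : ℕ} (h : MvPolynomial (Fin n) ℝ) : ℝ :=
  sSup ((fun θ => |evalPt h θ|) '' Metric.sphere (0 : EuclideanSpace ℝ (Fin n)) 1)

/-- The polynomial y ↦ p(t·y). -/
noncomputable def dilatePoly {n : ℕ} (p : MvPolynomial (Fin n) ℝ) (t : ℝ) :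
    MvPolynomial (Fin n) ℝ :=
  MvPolynomial.bind₁ (fun i => MvPolynomial.C t * MvPolynomial.X i) p

/-- The `m`-th moment of the (unnormalized) one-dimensional Gaussian weight. -/
noncomputable def gaussianMoment (m : ℕ) : ℝ :=
  ∫ t : ℝ, t ^ m * Real.exp (-(1 / 2) * t ^ 2)

/-- The (unnormalized) Gaussian weight on `ℝⁿ`. -/
noncomputable def gaussianWeight {n : ℕ} (x : Fin n → ℝ) : ℝ :=
  ∏ i, Real.exp (-(1 / 2) * x i ^ 2)

/-- The integral of a polynomial against the (unnormalized) Gaussian weight. -/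
noncomputable def gaussianIntegral {n : ℕ} (p : MvPolynomial (Fin n) ℝ) : ℝ :=
  ∫ x : Fin n → ℝ, MvPolynomial.eval x p * gaussianWeight x

theorem integrable_pow_mul_gaussian (m : ℕ) :
    MeasureTheory.Integrable fun t : ℝ => t ^ m * Real.exp (-(1 / 2) * t ^ 2) := by
  have h := integrable_rpow_mul_exp_neg_mul_sq (b := 1 / 2) (by norm_num) (s := m)
    (by linarith [(Nat.cast_nonneg m : (0 : ℝ) ≤ m)])
  simpa only [Real.rpow_natCast] using h

theorem gaussianMoment_succ (m : ℕ) :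
    gaussianMoment (m + 1) = m * gaussianMoment (m - 1) := by
  have hderiv : ∀ t : ℝ, HasDerivAt (fun t : ℝ => t ^ m * Real.exp (-(1 / 2) * t ^ 2))
      (m * (t ^ (m - 1) * Real.exp (-(1 / 2) * t ^ 2))
        - t ^ (m + 1) * Real.exp (-(1 / 2) * t ^ 2)) t := by
    intro t
    have h2 : HasDerivAt (fun t : ℝ => -(1 / 2) * t ^ 2) (-t) t :=
      ((hasDerivAt_pow 2 t).const_mul (-(1 / 2) : ℝ)).congr_deriv (by norm_num; ring)
    exact ((hasDerivAt_pow m t).mul h2.exp).congr_deriv (by ring)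
  have h1 := (integrable_pow_mul_gaussian (m - 1)).const_mul (m : ℝ)
  have h2 := integrable_pow_mul_gaussian (m + 1)
  have h := MeasureTheory.integral_eq_zero_of_hasDerivAt_of_integrable hderiv
    (h1.sub h2) (integrable_pow_mul_gaussian m)
  rw [MeasureTheory.integral_sub h1 h2, MeasureTheory.integral_const_mul] at h
  unfold gaussianMoment
  linarith

theorem gaussianWeight_pos {n : ℕ} (x : Fin n → ℝ) : 0 < gaussianWeight x :=
  Finset.prod_pos fun _ _ => Real.exp_pos _

theorem continuous_gaussianWeight {n : ℕ} :
    Continuous (gaussianWeight : (Fin n → ℝ) → ℝ) := by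
  unfold gaussianWeight
  fun_prop

theorem eval_monomial_mul_gaussianWeight {n : ℕ} (s : Fin n →₀ ℕ) (a : ℝ) (x : Fin n → ℝ) :
    MvPolynomial.eval x (monomial s a) * gaussianWeight x
      = a * ∏ i, (x i ^ s i * Real.exp (-(1 / 2) * x i ^ 2)) := by
  rw [gaussianWeight, MvPolynomial.eval_monomial, Finset.prod_mul_distrib,
    Finsupp.prod_fintype _ _ (by simp), mul_assoc]

theorem integrable_eval_mul_gaussianWeight {n : ℕ} (p : MvPolynomial (Fin n) ℝ) :
    MeasureTheory.Integrable fun x : Fin n → ℝ => MvPolynomial.eval x p * gaussianWeight x := by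
  induction p using MvPolynomial.induction_on' with
  | monomial s a =>
    simp only [eval_monomial_mul_gaussianWeight]
    exact (MeasureTheory.Integrable.fintype_prod
      (f := fun i (t : ℝ) => t ^ s i * Real.exp (-(1 / 2) * t ^ 2))
      fun i => integrable_pow_mul_gaussian (s i)).const_mul a
  | add p q hp hq =>
    simpa only [map_add, add_mul] using! hp.add hq

theorem gaussianIntegral_monomial {n : ℕ} (s : Fin n →₀ ℕ) (a : ℝ) :
    gaussianIntegral (monomial s a) = a * ∏ i, gaussianMoment (s i) := by
  simp only [gaussianIntegral, eval_monomial_mul_gaussianWeight]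
  rw [MeasureTheory.integral_const_mul, MeasureTheory.integral_fintype_prod_volume_eq_prod
    (fun i (t : ℝ) => t ^ s i * Real.exp (-(1 / 2) * t ^ 2))]
  rfl

theorem gaussianIntegral_add {n : ℕ} (p q : MvPolynomial (Fin n) ℝ) :
    gaussianIntegral (p + q) = gaussianIntegral p + gaussianIntegral q := by
  simp only [gaussianIntegral, map_add, add_mul]
  exact MeasureTheory.integral_add (integrable_eval_mul_gaussianWeight p)
    (integrable_eval_mul_gaussianWeight q)

theorem gaussianIntegral_smul {n : ℕ} (a : ℝ) (p : MvPolynomial (Fin n) ℝ) :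
    gaussianIntegral (a • p) = a * gaussianIntegral p := by
  simp only [gaussianIntegral, MvPolynomial.smul_eval, mul_assoc]
  exact MeasureTheory.integral_const_mul _ _

theorem gaussianIntegral_zero {n : ℕ} :
    gaussianIntegral (0 : MvPolynomial (Fin n) ℝ) = 0 := by
  simp [gaussianIntegral]

theorem gaussianIntegral_sum {n : ℕ} {ι : Type*} (s : Finset ι)
    (p : ι → MvPolynomial (Fin n) ℝ) :
    gaussianIntegral (∑ i ∈ s, p i) = ∑ i ∈ s, gaussianIntegral (p i) :=
  map_sum (AddMonoidHom.mk' gaussianIntegral gaussianIntegral_add) p s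

/-- Gaussian integration by parts (Stein's identity). -/
theorem gaussianIntegral_X_mul {n : ℕ} (i : Fin n) (p : MvPolynomial (Fin n) ℝ) :
    gaussianIntegral (X i * p) = gaussianIntegral (pderiv i p) := by
  induction p using MvPolynomial.induction_on' with
  | monomial s a =>
    rw [X, monomial_mul, pderiv_monomial, gaussianIntegral_monomial, gaussianIntegral_monomial,
      ← Finset.mul_prod_erase _ _ (Finset.mem_univ i),
      ← Finset.mul_prod_erase _ _ (Finset.mem_univ i)]
    have h : ∏ j ∈ Finset.univ.erase i, gaussianMoment ((Finsupp.single i 1 + s : Fin n →₀ ℕ) j)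
        = ∏ j ∈ Finset.univ.erase i, gaussianMoment ((s - Finsupp.single i 1 : Fin n →₀ ℕ) j) := by
      refine Finset.prod_congr rfl fun j hj => ?_
      simp [Finsupp.single_eq_of_ne (Finset.ne_of_mem_erase hj)]
    rw [h]
    simp only [Finsupp.add_apply, Finsupp.tsub_apply, Finsupp.single_eq_same]
    rw [add_comm 1 (s i), gaussianMoment_succ]
    ring
  | add p q hp hq =>
    rw [mul_add, gaussianIntegral_add, hp, hq, map_add, gaussianIntegral_add]

theorem gaussianIntegral_euler {n d : ℕ} {p : MvPolynomial (Fin n) ℝ} (hp : p.IsHomogeneous d) :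
    d * gaussianIntegral p = gaussianIntegral (∑ i, pderiv i (pderiv i p)) := by
  have h := congrArg gaussianIntegral hp.sum_X_mul_pderiv
  rw [gaussianIntegral_sum, ← Nat.cast_smul_eq_nsmul ℝ, gaussianIntegral_smul] at h
  rw [← h, gaussianIntegral_sum]
  exact Finset.sum_congr rfl fun i _ => gaussianIntegral_X_mul i _

theorem gaussianIntegral_eq_zero_of_isHarmonic {n d : ℕ} {p : MvPolynomial (Fin n) ℝ}
    (hd : d ≠ 0) (hp : p.IsHomogeneous d) (hharm : IsHarmonic p) : gaussianIntegral p = 0 := by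
  have h := gaussianIntegral_euler hp
  rw [hharm, gaussianIntegral_zero] at h
  exact (mul_eq_zero.1 h).resolve_left (Nat.cast_ne_zero.2 hd)

theorem IsHarmonic.pderiv {n : ℕ} {p : MvPolynomial (Fin n) ℝ} (hp : IsHarmonic p) (j : Fin n) :
    IsHarmonic (pderiv j p) := by
  have hcomm : ∀ i (q : MvPolynomial (Fin n) ℝ), MvPolynomial.pderiv i (MvPolynomial.pderiv j q)
      = MvPolynomial.pderiv j (MvPolynomial.pderiv i q) := by
    intro i q
    ext m
    by_cases hij : i = j
    · rw [hij]
    · simp only [coeff_pderiv, Finsupp.add_apply, Finsupp.single_eq_of_ne hij,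
        Finsupp.single_eq_of_ne (Ne.symm hij), add_zero, add_right_comm m]
      ring
  unfold IsHarmonic
  simp only [hcomm]
  rw [← map_sum, hp, map_zero]

theorem gaussianIntegral_X_mul_eq_zero_of_isHarmonic {n k : ℕ} {h : MvPolynomial (Fin n) ℝ}
    (hk : 2 ≤ k) (hh : h.IsHomogeneous k) (hharm : IsHarmonic h) (i : Fin n) :
    gaussianIntegral (X i * h) = 0 := by
  rw [gaussianIntegral_X_mul]
  exact gaussianIntegral_eq_zero_of_isHarmonic (by omega) hh.pderiv (hharm.pderiv i)

theorem eq_zero_of_gaussianIntegral_eq_zero {n : ℕ} {p : MvPolynomial (Fin n) ℝ}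
    (hnonneg : ∀ x : Fin n → ℝ, 0 ≤ MvPolynomial.eval x p) (hint : gaussianIntegral p = 0) :
    p = 0 := by
  have h := (MeasureTheory.integral_eq_zero_iff_of_nonneg
    (fun x => mul_nonneg (hnonneg x) (gaussianWeight_pos x).le)
    (integrable_eval_mul_gaussianWeight p)).1 hint
  have hcont : Continuous fun x : Fin n → ℝ => MvPolynomial.eval x p * gaussianWeight x :=
    (MvPolynomial.continuous_eval p).mul continuous_gaussianWeight
  have h' := (hcont.ae_eq_iff_eq MeasureTheory.volume continuous_zero).1 h
  refine MvPolynomial.funext fun x => ?_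
  rw [map_zero]
  exact (mul_eq_zero.1 (congrFun h' x)).resolve_right (gaussianWeight_pos x).ne'

theorem eval_smul_of_isHomogeneous {n k : ℕ} {h : MvPolynomial (Fin n) ℝ}
    (hh : h.IsHomogeneous k) (t : ℝ) (x : Fin n → ℝ) :
    MvPolynomial.eval (t • x) h = t ^ k * MvPolynomial.eval x h := by
  rw [MvPolynomial.eval_eq', MvPolynomial.eval_eq', Finset.mul_sum]
  refine Finset.sum_congr rfl fun s hs => ?_
  have hdeg : ∑ i, s i = k := by
    rw [← Finsupp.degree_eq_sum, Finsupp.degree_eq_weight_one]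
    exact hh (mem_support_iff.1 hs)
  simp only [Pi.smul_apply, smul_eq_mul, mul_pow, Finset.prod_mul_distrib,
    Finset.prod_pow_eq_pow_sum, hdeg]
  ring

theorem eval_nonneg_of_nonneg_on_halfspace {n : ℕ} {h : MvPolynomial (Fin n) ℝ}
    {v : Fin n → ℝ} (hv : v ≠ 0)
    (hpos : ∀ x : Fin n → ℝ, 0 < v ⬝ᵥ x → 0 ≤ MvPolynomial.eval x h)
    {x : Fin n → ℝ} (hx : 0 ≤ v ⬝ᵥ x) : 0 ≤ MvPolynomial.eval x h := by
  have hlim : Tendsto (fun t : ℝ => MvPolynomial.eval (x + t • v) h)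
      (nhdsWithin 0 (Set.Ioi 0)) (nhds (MvPolynomial.eval x h)) := by
    have hc : Continuous fun t : ℝ => MvPolynomial.eval (x + t • v) h :=
      (MvPolynomial.continuous_eval h).comp (by fun_prop)
    simpa using (hc.tendsto 0).mono_left nhdsWithin_le_nhds
  refine ge_of_tendsto hlim ?_
  filter_upwards [self_mem_nhdsWithin] with t ht
  refine hpos _ ?_
  rw [dotProduct_add, dotProduct_smul, smul_eq_mul]
  have hvv : 0 < v ⬝ᵥ v := (Finset.sum_nonneg fun i _ => mul_self_nonneg (v i)).lt_of_ne'
    (mt dotProduct_self_eq_zero.1 hv)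
  exact add_pos_of_nonneg_of_pos hx (mul_pos ht hvv)

/-- A homogeneous harmonic polynomial of degree at least two that is nonnegative on an open
half-space vanishes identically. -/
theorem eq_zero_of_nonneg_on_halfspace {n k : ℕ} (hk : 2 ≤ k) {h : MvPolynomial (Fin n) ℝ}
    (hh : h.IsHomogeneous k) (hharm : IsHarmonic h) {v : Fin n → ℝ} (hv : v ≠ 0)
    (hpos : ∀ x : Fin n → ℝ, 0 < v ⬝ᵥ x → 0 ≤ MvPolynomial.eval x h) : h = 0 := by
  have hpos' : ∀ x : Fin n → ℝ, 0 ≤ v ⬝ᵥ x → 0 ≤ MvPolynomial.eval x h :=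
    fun x hx => eval_nonneg_of_nonneg_on_halfspace hv hpos hx
  have hneg : ∀ x : Fin n → ℝ, v ⬝ᵥ x ≤ 0 → 0 ≤ (-1) ^ k * MvPolynomial.eval x h := by
    intro x hx
    rw [← eval_smul_of_isHomogeneous hh]
    exact hpos' _ (by simpa using hx)
  rcases Nat.even_or_odd k with hek | hok
  · refine eq_zero_of_gaussianIntegral_eq_zero (fun x => ?_)
      (gaussianIntegral_eq_zero_of_isHarmonic (by omega) hh hharm)
    rcases le_total 0 (v ⬝ᵥ x) with hx | hx
    · exact hpos' x hx
    · simpa [hek.neg_one_pow] using hneg x hx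
  · set l : MvPolynomial (Fin n) ℝ := ∑ i, C (v i) * X i with hl
    have heval : ∀ x, MvPolynomial.eval x l = v ⬝ᵥ x := fun x => by simp [hl, dotProduct]
    have hl0 : l ≠ 0 := by
      intro h0
      have := heval v
      rw [h0, map_zero] at this
      exact hv (dotProduct_self_eq_zero.1 this.symm)
    refine (mul_eq_zero.1 (eq_zero_of_gaussianIntegral_eq_zero (p := l * h)
      (fun x => ?_) ?_)).resolve_left hl0
    · rw [map_mul, heval]
      rcases le_total 0 (v ⬝ᵥ x) with hx | hx
      · exact mul_nonneg hx (hpos' x hx)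
      · refine mul_nonneg_of_nonpos_of_nonpos hx ?_
        simpa [hok.neg_one_pow] using hneg x hx
    · rw [hl, Finset.sum_mul, gaussianIntegral_sum]
      refine Finset.sum_eq_zero fun i _ => ?_
      rw [mul_assoc, ← smul_eq_C_mul, gaussianIntegral_smul,
        gaussianIntegral_X_mul_eq_zero_of_isHarmonic hk hh hharm, mul_zero]

/-- The space of homogeneous harmonic polynomials of degree `k`. -/
noncomputable def homogeneousHarmonic (n k : ℕ) : Submodule ℝ (MvPolynomial (Fin n) ℝ) :=
  homogeneousSubmodule (Fin n) ℝ k ⊓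
    LinearMap.ker (∑ i : Fin n, (pderiv i).toLinearMap ∘ₗ (pderiv (R := ℝ) i).toLinearMap)

theorem mem_homogeneousHarmonic {n k : ℕ} {h : MvPolynomial (Fin n) ℝ} :
    h ∈ homogeneousHarmonic n k ↔ h.IsHomogeneous k ∧ IsHarmonic h := by
  simp [homogeneousHarmonic, IsHarmonic]

instance (n k : ℕ) : FiniteDimensional ℝ (homogeneousHarmonic n k) :=
  have : FiniteDimensional ℝ (homogeneousSubmodule (Fin n) ℝ k) :=
    Module.Finite.iff_fg.2 (homogeneousSubmodule_fg _ _ k)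
  Submodule.finiteDimensional_of_le inf_le_left

/-- The part of the open half-space `0 < ⟪x, v⟫` that lies outside the cone
`⟪x, v⟫ < ε * ‖x‖` around the hyperplane orthogonal to `v`. -/
def halfCone {n : ℕ} (v : EuclideanSpace ℝ (Fin n)) (ε : ℝ) : Set (EuclideanSpace ℝ (Fin n)) :=
  {x | 0 < inner ℝ v x ∧ ε * ‖x‖ ≤ inner ℝ v x}

theorem convex_halfCone {n : ℕ} (v : EuclideanSpace ℝ (Fin n)) {ε : ℝ} (hε : 0 ≤ ε) :
    Convex ℝ (halfCone v ε) := by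
  rintro x ⟨hx0, hx⟩ y ⟨hy0, hy⟩ a b ha hb hab
  have hinner : inner ℝ v (a • x + b • y) = a * inner ℝ v x + b * inner ℝ v y := by
    rw [inner_add_right, real_inner_smul_right, real_inner_smul_right]
  refine ⟨?_, ?_⟩
  · rw [hinner]
    rcases ha.eq_or_lt with rfl | ha'
    · have : b = 1 := by linarith
      simpa [this] using hy0
    · nlinarith [mul_pos ha' hx0, mul_nonneg hb hy0.le]
  · have hnorm : ‖a • x + b • y‖ ≤ a * ‖x‖ + b * ‖y‖ := by
      refine (norm_add_le _ _).trans_eq ?_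
      rw [norm_smul, norm_smul, Real.norm_of_nonneg ha, Real.norm_of_nonneg hb]
    rw [hinner]
    nlinarith [mul_le_mul_of_nonneg_left hnorm hε, mul_le_mul_of_nonneg_left hx ha,
      mul_le_mul_of_nonneg_left hy hb]

theorem continuous_evalPt {n : ℕ} (p : MvPolynomial (Fin n) ℝ) : Continuous (evalPt p) :=
  (MvPolynomial.continuous_eval p).comp (by fun_prop)

theorem evalPt_smul_of_isHomogeneous {n k : ℕ} {h : MvPolynomial (Fin n) ℝ}
    (hh : h.IsHomogeneous k) (t : ℝ) (x : EuclideanSpace ℝ (Fin n)) :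
    evalPt h (t • x) = t ^ k * evalPt h x :=
  eval_smul_of_isHomogeneous hh t _

/-- By compactness, a nonzero homogeneous harmonic polynomial of degree at least two takes a
negative value on every half-cone with a uniformly small parameter. -/
theorem exists_pos_forall_exists_mem_halfCone_neg (n k : ℕ) (hk : 2 ≤ k) :
    ∃ ε : ℝ, 0 < ε ∧ ∀ h : MvPolynomial (Fin n) ℝ, h ≠ 0 → IsHarmonic h → h.IsHomogeneous k →
      ∀ v : EuclideanSpace ℝ (Fin n), ‖v‖ = 1 → ∃ x ∈ halfCone v ε, evalPt h x < 0 := by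
  by_contra! H
  let W := homogeneousHarmonic n k
  let b := Module.finBasis ℝ W
  let P : (Fin (Module.finrank ℝ W) → ℝ) → W := b.equivFun.symm
  have hP : ∀ c x, evalPt (P c : MvPolynomial (Fin n) ℝ) x = ∑ i, c i * evalPt (b i).1 x := by
    intro c x
    simp [P, b.equivFun_symm_apply, evalPt, MvPolynomial.smul_eval]
  have hseq : ∀ m : ℕ, ∃ z : (Fin (Module.finrank ℝ W) → ℝ) × EuclideanSpace ℝ (Fin n),
      z ∈ sphere 0 1 ×ˢ sphere 0 1 ∧
        ∀ x ∈ halfCone z.2 (1 / ((m : ℝ) + 1)), 0 ≤ evalPt (P z.1).1 x := by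
    intro m
    obtain ⟨h, h0, hharm, hh, v, hv, hpos⟩ := H (1 / ((m : ℝ) + 1)) (by positivity)
    let w : W := ⟨h, mem_homogeneousHarmonic.2 ⟨hh, hharm⟩⟩
    have hw : b.equivFun w ≠ 0 := fun h' => h0 (congrArg Subtype.val
      (b.equivFun.map_eq_zero_iff.1 h'))
    refine ⟨(‖b.equivFun w‖⁻¹ • b.equivFun w, v), ⟨?_, by simpa using hv⟩, fun x hx => ?_⟩
    · exact mem_sphere_zero_iff_norm.2 (norm_smul_inv_norm hw)
    · have : P (‖b.equivFun w‖⁻¹ • b.equivFun w) = ‖b.equivFun w‖⁻¹ • w := by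
        simp only [P, map_smul, LinearEquiv.symm_apply_apply]
      simp only [this, evalPt, Submodule.coe_smul, MvPolynomial.smul_eval]
      exact mul_nonneg (inv_nonneg.2 (norm_nonneg _)) (hpos x hx)
  choose z hz hzpos using hseq
  obtain ⟨⟨c, v⟩, ⟨hc, hv⟩, φ, hφ, hlim⟩ :=
    ((isCompact_sphere _ _).prod (isCompact_sphere _ _)).tendsto_subseq hz
  have hlim1 : Tendsto (fun m => (z (φ m)).1) atTop (nhds c) := hlim.fst_nhds
  have hlim2 : Tendsto (fun m => (z (φ m)).2) atTop (nhds v) := hlim.snd_nhds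
  have hPc : (P c).1 = 0 := by
    obtain ⟨hhom, hharm⟩ := mem_homogeneousHarmonic.1 (P c).2
    have hv0 : v ≠ 0 := fun h => by simp [h] at hv
    refine eq_zero_of_nonneg_on_halfspace hk hhom hharm (v := v.ofLp)
      (by simpa using hv0) fun y hy => ?_
    let x : EuclideanSpace ℝ (Fin n) := WithLp.toLp 2 y
    have hx : 0 < inner ℝ v x := by
      simpa [x, PiLp.inner_apply, dotProduct, mul_comm] using hy
    have hin : Tendsto (fun m => inner ℝ (z (φ m)).2 x) atTop (nhds (inner ℝ v x)) :=
      hlim2.inner tendsto_const_nhds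
    have hsmall : Tendsto (fun m => 1 / ((φ m : ℝ) + 1) * ‖x‖) atTop (nhds 0) := by
      simpa using (tendsto_one_div_add_atTop_nhds_zero_nat.comp hφ.tendsto_atTop).mul_const ‖x‖
    have heval : Tendsto (fun m => evalPt (P (z (φ m)).1).1 x) atTop
        (nhds (evalPt (P c).1 x)) := by
      simp only [hP]
      exact tendsto_finsetSum _ fun i _ => ((tendsto_pi_nhds.1 hlim1) i).mul_const _
    refine ge_of_tendsto heval ?_
    filter_upwards [hin.eventually_const_lt hx, hsmall.eventually_lt hin hx] with m h1 h2
    exact hzpos _ x ⟨h1, h2.le⟩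
  have hc0 : c = 0 := b.equivFun.symm.map_eq_zero_iff.1 (Subtype.ext hPc)
  simp [hc0] at hc

theorem exists_submodule_finrank_eq_sub_one (n : ℕ) (hn : 1 ≤ n) :
    ∃ L : Submodule ℝ (EuclideanSpace ℝ (Fin n)), Module.finrank ℝ L = n - 1 := by
  have : Nonempty (Fin n) := ⟨⟨0, hn⟩⟩
  obtain ⟨v, hv⟩ := exists_ne (0 : EuclideanSpace ℝ (Fin n))
  refine ⟨(ℝ ∙ v)ᗮ, ?_⟩
  have h := (ℝ ∙ v).finrank_add_finrank_orthogonal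
  rw [finrank_span_singleton hv, finrank_euclideanSpace_fin] at h
  omega

theorem exists_norm_eq_one_forall_inner_eq_zero {n : ℕ} (hn : 1 ≤ n)
    {L : Submodule ℝ (EuclideanSpace ℝ (Fin n))} (hL : Module.finrank ℝ L = n - 1) :
    ∃ v : EuclideanSpace ℝ (Fin n), ‖v‖ = 1 ∧ ∀ x ∈ L, inner ℝ v x = 0 := by
  have hne : Lᗮ ≠ ⊥ := by
    intro h
    have h' := L.finrank_add_finrank_orthogonal
    rw [h, finrank_bot, finrank_euclideanSpace_fin] at h'
    omega
  obtain ⟨w, hw, hw0⟩ := Submodule.exists_mem_ne_zero_of_ne_bot hne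
  refine ⟨‖w‖⁻¹ • w, norm_smul_inv_norm hw0, fun x hx => ?_⟩
  rw [real_inner_smul_left, Submodule.inner_left_of_mem_orthogonal hx hw, mul_zero]

/-- If the zero set of a homogeneous polynomial is close to the hyperplane orthogonal to `v` at
some scale, then it avoids the corresponding half-cone. -/
theorem evalPt_ne_zero_of_mem_halfCone {n k : ℕ} {h : MvPolynomial (Fin n) ℝ}
    (hh : h.IsHomogeneous k) (hk : k ≠ 0) {L : Submodule ℝ (EuclideanSpace ℝ (Fin n))}
    {v : EuclideanSpace ℝ (Fin n)} (hv : ‖v‖ = 1) (hvL : ∀ x ∈ L, inner ℝ v x = 0)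
    {ε r : ℝ} (hr : 0 < r)
    (hdist : hausdorffDist (zeroSet h ∩ closedBall 0 r)
      ((L : Set (EuclideanSpace ℝ (Fin n))) ∩ closedBall 0 r) < ε * r)
    {x : EuclideanSpace ℝ (Fin n)} (hx : x ∈ halfCone v ε) : evalPt h x ≠ 0 := by
  intro hx0
  have hxne : x ≠ 0 := fun h' => by simpa [h'] using hx.1
  have hxn : 0 < ‖x‖ := norm_pos_iff.2 hxne
  have hzero : (0 : EuclideanSpace ℝ (Fin n)) ∈ zeroSet h := by
    have := evalPt_smul_of_isHomogeneous hh 0 x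
    rwa [zero_smul, zero_pow hk, zero_mul] at this
  have hball : (0 : EuclideanSpace ℝ (Fin n)) ∈ closedBall 0 r := mem_closedBall_self hr.le
  have hy : (r / ‖x‖) • x ∈ zeroSet h ∩ closedBall 0 r := by
    refine ⟨?_, ?_⟩
    · change evalPt h _ = 0
      rw [evalPt_smul_of_isHomogeneous hh, hx0, mul_zero]
    · rw [mem_closedBall_zero_iff, norm_smul, Real.norm_of_nonneg (by positivity),
        div_mul_cancel₀ _ hxn.ne']
  obtain ⟨w, hw, hlt⟩ := exists_dist_lt_of_hausdorffDist_lt hy hdist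
    (hausdorffEDist_ne_top_of_nonempty_of_bounded ⟨0, hzero, hball⟩ ⟨0, L.zero_mem, hball⟩
      (isBounded_closedBall.subset Set.inter_subset_right)
      (isBounded_closedBall.subset Set.inter_subset_right))
  have h1 : inner ℝ v ((r / ‖x‖) • x - w) = r / ‖x‖ * inner ℝ v x := by
    rw [inner_sub_right, hvL w hw.1, sub_zero, real_inner_smul_right]
  have h2 : inner ℝ v ((r / ‖x‖) • x - w) ≤ dist ((r / ‖x‖) • x) w := by
    rw [dist_eq_norm]
    simpa [hv] using real_inner_le_norm v ((r / ‖x‖) • x - w)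
  have h3 : ε * r ≤ r / ‖x‖ * inner ℝ v x := by
    calc ε * r = r / ‖x‖ * (ε * ‖x‖) := by field_simp
      _ ≤ _ := by gcongr; exact hx.2
  linarith

/-- Zero sets of homogeneous harmonic polynomials of degree ≥ 2 are uniformly far from
flat at the origin, at every scale. -/
theorem homogeneous_nonflat (n k : ℕ) (hn : 2 ≤ n) (hk : 2 ≤ k) :
    ∃ δ : ℝ, 0 < δ ∧ ∀ h : MvPolynomial (Fin n) ℝ, h ≠ 0 → IsHarmonic h →
      h.IsHomogeneous k → ∀ r > (0 : ℝ), δ ≤ flatness (zeroSet h) 0 r := by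
  obtain ⟨ε, hε, hcone⟩ := exists_pos_forall_exists_mem_halfCone_neg n k hk
  refine ⟨ε, hε, fun h h0 hharm hh r hr => ?_⟩
  have hne : Nonempty {L : Submodule ℝ (EuclideanSpace ℝ (Fin n)) //
      Module.finrank ℝ L = n - 1} :=
    nonempty_subtype.2 (exists_submodule_finrank_eq_sub_one n (by omega))
  rw [flatness, one_div, le_inv_mul_iff₀ hr, mul_comm]
  refine le_ciInf fun ⟨L, hL⟩ => ?_
  simp only [zero_add, Set.image_id']
  by_contra! hlt
  obtain ⟨v, hv, hvL⟩ := exists_norm_eq_one_forall_inner_eq_zero (by omega) hL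
  obtain ⟨x, hx, hxneg⟩ := hcone h h0 hharm hh v hv
  have hneg_mem := mem_homogeneousHarmonic.1
    (neg_mem (mem_homogeneousHarmonic.2 ⟨hh, hharm⟩))
  obtain ⟨y, hy, hypos⟩ := hcone (-h) (neg_ne_zero.2 h0) hneg_mem.2 hneg_mem.1 v hv
  have hypos' : 0 < evalPt h y := by simpa [evalPt] using hypos
  obtain ⟨w, hw, hw0⟩ := (convex_halfCone v hε.le).isPreconnected.intermediate_value hx hy
    (continuous_evalPt h).continuousOn ⟨hxneg.le, hypos'.le⟩
  exact evalPt_ne_zero_of_mem_halfCone hh (by omega) hv hvL hr hlt hw hw0
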